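/- Let Q be a lattice path from (0,0) to (m,r) and let P = E^m N^r. Then the number of edges (one-dimensional faces) of the lattice path matroid polytope P(M[E^m N^r, Q]) equals the sum, over all lattice paths L from (0,0) to (m,r) with L never going above Q, of the area below L, namely Σ_{i=1}^{m+r} (N(L,i) − N(E^m N^r, i)) (equivalently, the sum over the East steps of L of their heights). -/

import Mathlib

/-- Number of North steps among the first `i` steps of the lattice path `P`
(steps are indexed `1, …, n`; `P j = true` means step `j` is a North step). -/
def NCt (P : ℕ → Bool) (i : ℕ) : ℕ :=
  ((Finset.Icc 1 i).filter (fun j => P j = true)).card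

/-- `P` is a lattice path from `(0,0)` to `(m,r)`: it has exactly `r` North steps
among its `m + r` steps. -/
def IsPath (m r : ℕ) (P : ℕ → Bool) : Prop := NCt P (m + r) = r

/-- `P` never goes above `Q`. -/
def Below (n : ℕ) (P Q : ℕ → Bool) : Prop := ∀ i ≤ n, NCt P i ≤ NCt Q i

/-- `B` is a basis of the lattice path matroid `M[P,Q]`: an `r`-element subset of
`{1, …, m+r}` whose associated lattice path stays between `P` and `Q`. -/
def IsLPBasis (m r : ℕ) (P Q : ℕ → Bool) (B : Finset ℕ) : Prop :=
  B ⊆ Finset.Icc 1 (m + r) ∧ B.card = r ∧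
    ∀ i ≤ m + r, NCt P i ≤ (B.filter (fun j => j ≤ i)).card ∧
      (B.filter (fun j => j ≤ i)).card ≤ NCt Q i

/-- The 0/1 indicator vector in `ℝ^n` of a subset `B ⊆ {1, …, n}`. -/
def ind (n : ℕ) (B : Finset ℕ) : Fin n → ℝ :=
  fun i => if (i : ℕ) + 1 ∈ B then 1 else 0

/-- The lattice path matroid polytope: the convex hull of the indicator vectors of
the bases of `M[P,Q]`. -/
def LPMPoly (m r : ℕ) (P Q : ℕ → Bool) : Set (Fin (m + r) → ℝ) :=
  convexHull ℝ (ind (m + r) '' {B | IsLPBasis m r P Q B})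

/-- `F` is a face of `S`: a convex subset such that whenever a point of `F` lies in
the open segment between two points of `S`, both endpoints lie in `F`. -/
def IsFace {n : ℕ} (S F : Set (Fin n → ℝ)) : Prop :=
  F ⊆ S ∧ Convex ℝ F ∧
    ∀ x ∈ S, ∀ y ∈ S, ∀ z ∈ openSegment ℝ x y, z ∈ F → x ∈ F ∧ y ∈ F

/-- The dimension of the affine hull of a set in `ℝ^n`. -/
noncomputable def fdim {n : ℕ} (F : Set (Fin n → ℝ)) : ℕ :=
  Module.finrank ℝ (affineSpan ℝ F).direction

/-- A facet: a nonempty face whose dimension is one less than that of the polytope. -/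
def IsFacet {n : ℕ} (S F : Set (Fin n → ℝ)) : Prop :=
  F.Nonempty ∧ IsFace S F ∧ fdim F + 1 = fdim S

/-- The finite set of all bases of `M[P,Q]`; these correspond bijectively to the
lattice paths `L` from `(0,0)` to `(m,r)` with `P ≤ L ≤ Q` (a basis is the set of
positions of the North steps of `L`). -/
noncomputable def basesFinset (m r : ℕ) (P Q : ℕ → Bool) : Finset (Finset ℕ) :=
  letI := Classical.decPred (IsLPBasis m r P Q)
  (Finset.Icc 1 (m + r)).powerset.filter (IsLPBasis m r P Q)

/-- `pathN B i` is the number of North steps among the first `i` steps of the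
lattice path whose North steps are at the positions in `B`. -/
def pathN (B : Finset ℕ) (i : ℕ) : ℕ := (B.filter (fun j => j ≤ i)).card

/-- The path `E^m N^r`: the first `m` steps are East, the last `r` steps are North. -/
def EmNr (m : ℕ) : ℕ → Bool := fun i => decide (m < i)

lemma NCt_EmNr (m i : ℕ) : NCt (EmNr m) i = i - m := by
  have h : (Finset.Icc 1 i).filter (fun j => EmNr m j = true) = Finset.Ioc m i := by
    ext j
    simp only [EmNr, Finset.mem_filter, Finset.mem_Icc, Finset.mem_Ioc, decide_eq_true_eq]
    omega
  rw [NCt, h, Nat.card_Ioc]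

/-- The lower bound in the definition of a basis is automatic for `P = E^m N^r`. -/
lemma isLPBasis_EmNr_iff {m r : ℕ} {Q : ℕ → Bool} {B : Finset ℕ} :
    IsLPBasis m r (EmNr m) Q B ↔
      B ⊆ Finset.Icc 1 (m + r) ∧ B.card = r ∧ ∀ i ≤ m + r, pathN B i ≤ NCt Q i := by
  refine ⟨fun h => ⟨h.1, h.2.1, fun i hi => (h.2.2 i hi).2⟩,
    fun h => ⟨h.1, h.2.1, fun i hi => ⟨?_, h.2.2 i hi⟩⟩⟩
  have hcard := Finset.card_filter_add_card_filter_not (s := B) (fun j => j ≤ i)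
  have hle : (B.filter (fun j => ¬ j ≤ i)).card ≤ (Finset.Ioc i (m + r)).card := by
    refine Finset.card_le_card fun j hj => ?_
    have hj := Finset.mem_filter.1 hj
    have := Finset.mem_Icc.1 (h.1 hj.1)
    rw [Finset.mem_Ioc]
    omega
  rw [Nat.card_Ioc] at hle
  rw [NCt_EmNr]
  have := h.2.1
  omega

lemma mem_basesFinset {m r : ℕ} {P Q : ℕ → Bool} {B : Finset ℕ} :
    B ∈ basesFinset m r P Q ↔ IsLPBasis m r P Q B := by
  simp only [basesFinset, Finset.mem_filter, Finset.mem_powerset, and_iff_right_iff_imp]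
  exact fun h => h.1

/-- The set obtained from `B` by exchanging `a` for `b`. -/
def swapElem (B : Finset ℕ) (a b : ℕ) : Finset ℕ := insert b (B.erase a)

lemma card_swapElem {B : Finset ℕ} {a b : ℕ} (ha : a ∈ B) (hb : b ∉ B) :
    (swapElem B a b).card = B.card := by
  have hb' : b ∉ B.erase a := fun h => hb (Finset.mem_of_mem_erase h)
  rw [swapElem, Finset.card_insert_of_notMem hb', Finset.card_erase_add_one ha]

lemma pathN_swapElem {B : Finset ℕ} {a b : ℕ} (ha : a ∈ B) (hb : b ∉ B) (i : ℕ) :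
    pathN (swapElem B a b) i + (if a ≤ i then 1 else 0) =
      pathN B i + (if b ≤ i then 1 else 0) := by
  have hb' : b ∉ B.erase a := fun h => hb (Finset.mem_of_mem_erase h)
  simp only [pathN, swapElem, Finset.card_filter]
  rw [Finset.sum_insert hb', ← Finset.sum_erase_add B _ ha]
  ring

lemma swapElem_subset {B S : Finset ℕ} {a b : ℕ} (hB : B ⊆ S) (hb : b ∈ S) :
    swapElem B a b ⊆ S :=
  Finset.insert_subset hb ((Finset.erase_subset a B).trans hB)

/-- Moving a North step of a path to the right of it yields a path below it. -/
lemma isLPBasis_swapElem_of_lt {m r : ℕ} {Q : ℕ → Bool} {B : Finset ℕ} {a b : ℕ}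
    (h : IsLPBasis m r (EmNr m) Q B) (ha : a ∈ B) (hb : b ∉ B)
    (hbn : b ∈ Finset.Icc 1 (m + r)) (hab : a < b) :
    IsLPBasis m r (EmNr m) Q (swapElem B a b) := by
  rw [isLPBasis_EmNr_iff] at h ⊢
  refine ⟨swapElem_subset h.1 hbn, (card_swapElem ha hb).trans h.2.1, fun i hi => ?_⟩
  have h1 := pathN_swapElem ha hb i
  have h2 := h.2.2 i hi
  split_ifs at h1 <;> omega

lemma isLPBasis_swapElem_of_forall {m r : ℕ} {Q : ℕ → Bool} {B C : Finset ℕ} {a b : ℕ}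
    (hB : IsLPBasis m r (EmNr m) Q B) (hC : IsLPBasis m r (EmNr m) Q C)
    (ha : a ∈ B \ C) (hb : b ∈ C \ B) (h : ∀ c ∈ C, c < b → c ∈ B) :
    IsLPBasis m r (EmNr m) Q (swapElem C b a) := by
  rw [Finset.mem_sdiff] at ha hb
  rw [isLPBasis_EmNr_iff] at hB hC ⊢
  refine ⟨swapElem_subset hC.1 (hB.1 ha.1), (card_swapElem hb.1 ha.2).trans hC.2.1,
    fun i hi => ?_⟩
  have h1 := pathN_swapElem hb.1 ha.2 i
  have h2 := hC.2.2 i hi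
  by_cases hi' : a ≤ i ∧ i < b
  · have hsub : C.filter (fun j => j ≤ i) ⊆ (B.filter (fun j => j ≤ i)).erase a := by
      intro c hc
      rw [Finset.mem_filter] at hc
      refine Finset.mem_erase.2 ⟨?_, Finset.mem_filter.2 ⟨h c hc.1 (by omega), hc.2⟩⟩
      rintro rfl
      exact ha.2 hc.1
    have h3 := Finset.card_le_card hsub
    have ha' : a ∈ B.filter (fun j => j ≤ i) := Finset.mem_filter.2 ⟨ha.1, hi'.1⟩
    have h4 := Finset.card_erase_add_one ha'
    have h5 := hB.2.2 i hi
    simp only [pathN] at *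
    split_ifs at h1 <;> omega
  · split_ifs at h1 <;> omega

/-- Two distinct sets of the same size admit an exchange of first differences. -/
lemma exists_first_exchange {B C : Finset ℕ} (hne : B ≠ C) (hcard : B.card = C.card) :
    (∃ a ∈ B \ C, ∃ b ∈ C \ B, a < b ∧ ∀ c ∈ C, c < b → c ∈ B) ∨
      ∃ a ∈ C \ B, ∃ b ∈ B \ C, a < b ∧ ∀ c ∈ B, c < b → c ∈ C := by
  have h1 : (B \ C).Nonempty := by
    rw [Finset.sdiff_nonempty]
    exact fun h => hne (Finset.eq_of_subset_of_card_le h hcard.ge)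
  have h2 : (C \ B).Nonempty := by
    rw [Finset.sdiff_nonempty]
    exact fun h => hne (Finset.eq_of_subset_of_card_le h hcard.le).symm
  have hmin : ∀ {X Y : Finset ℕ} (h : (X \ Y).Nonempty), ∀ c ∈ X, c < (X \ Y).min' h → c ∈ Y := by
    intro X Y h c hc hlt
    by_contra hn
    exact (Finset.min'_le _ c (Finset.mem_sdiff.2 ⟨hc, hn⟩)).not_gt hlt
  have m1 := Finset.min'_mem _ h1
  have m2 := Finset.min'_mem _ h2
  rcases lt_trichotomy ((B \ C).min' h1) ((C \ B).min' h2) with h | h | h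
  · exact Or.inl ⟨_, m1, _, m2, h, hmin h2⟩
  · rw [h] at m1
    exact absurd (Finset.mem_sdiff.1 m2).1 (Finset.mem_sdiff.1 m1).2
  · exact Or.inr ⟨_, m2, _, m1, h, hmin h1⟩

lemma eq_of_ind_eq {n : ℕ} {B C : Finset ℕ} (hB : B ⊆ Finset.Icc 1 n) (hC : C ⊆ Finset.Icc 1 n)
    (h : ind n B = ind n C) : B = C := by
  have key : ∀ j ∈ Finset.Icc 1 n, (j ∈ B ↔ j ∈ C) := by
    intro j hj
    rw [Finset.mem_Icc] at hj
    have := congrFun h ⟨j - 1, by omega⟩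
    simp only [ind, Nat.sub_add_cancel hj.1] at this
    split_ifs at this <;> simp_all
  ext j
  exact ⟨fun hj => (key j (hB hj)).1 hj, fun hj => (key j (hC hj)).2 hj⟩

lemma ind_swapElem_add {n : ℕ} {B C : Finset ℕ} {a b : ℕ} (ha : a ∈ B \ C) (hb : b ∈ C \ B) :
    ind n (swapElem B a b) + ind n (swapElem C b a) = ind n B + ind n C := by
  rw [Finset.mem_sdiff] at ha hb
  have hab : a ≠ b := by rintro rfl; exact ha.2 hb.1
  ext i
  simp only [ind, swapElem, Pi.add_apply, Finset.mem_insert, Finset.mem_erase]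
  by_cases h1 : (i : ℕ) + 1 = a
  · simp [h1, ha, hab]
  by_cases h2 : (i : ℕ) + 1 = b
  · simp [h2, hb, hab.symm]
  · simp [h1, h2]

/-- The only 0/1 points of a segment between 0/1 points are its ends. -/
lemma eq_or_eq_of_ind_mem_segment {n : ℕ} {B C D : Finset ℕ}
    (h : ind n D ∈ segment ℝ (ind n B) (ind n C)) :
    ind n D = ind n B ∨ ind n D = ind n C := by
  by_cases hBC : ind n B = ind n C
  · rw [← hBC, segment_same] at h
    exact Or.inl h
  obtain ⟨s, t, hs, ht, hst, h⟩ := h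
  obtain ⟨i, hi⟩ := Function.ne_iff.1 hBC
  have hDi := congrFun h i
  have hor : s = 0 ∨ t = 0 := by
    simp only [ind, Pi.add_apply, Pi.smul_apply, smul_eq_mul] at hDi hi
    split_ifs at hDi hi <;> simp_all
  rcases hor with rfl | rfl
  · right; simp_all
  · left; simp_all

section Polytope

variable {m r : ℕ} {P Q : ℕ → Bool}

lemma ind_mem_LPMPoly {B : Finset ℕ} (h : IsLPBasis m r P Q B) :
    ind (m + r) B ∈ LPMPoly m r P Q :=
  subset_convexHull ℝ _ ⟨B, h, rfl⟩

lemma LPMPoly_subset_cube {x : Fin (m + r) → ℝ} (hx : x ∈ LPMPoly m r P Q) (i : Fin (m + r)) :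
    0 ≤ x i ∧ x i ≤ 1 := by
  have hconv : Convex ℝ (Set.Icc (0 : Fin (m + r) → ℝ) 1) := convex_Icc _ _
  have hsub : LPMPoly m r P Q ⊆ Set.Icc 0 1 := by
    refine convexHull_min ?_ hconv
    rintro _ ⟨B, -, rfl⟩
    constructor <;> intro j <;> simp only [ind, Pi.zero_apply, Pi.one_apply] <;>
      split_ifs <;> norm_num
  exact ⟨(hsub hx).1 i, (hsub hx).2 i⟩

lemma sum_ind {n : ℕ} {B : Finset ℕ} (hB : B ⊆ Finset.Icc 1 n) : ∑ i, ind n B i = B.card := by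
  simp only [ind]
  rw [Fin.sum_univ_eq_sum_range (fun i => if i + 1 ∈ B then (1 : ℝ) else 0) n,
    Finset.sum_boole, Nat.cast_inj]
  refine Finset.card_bij (fun i _ => i + 1) (fun i hi => (Finset.mem_filter.1 hi).2)
    (fun i _ j _ h => by omega) fun j hj => ?_
  have hj' := Finset.mem_Icc.1 (hB hj)
  refine ⟨j - 1, Finset.mem_filter.2 ⟨Finset.mem_range.2 (by omega), ?_⟩, by omega⟩
  rwa [Nat.sub_add_cancel hj'.1]

lemma sum_eq_of_mem_LPMPoly {x : Fin (m + r) → ℝ} (hx : x ∈ LPMPoly m r P Q) :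
    ∑ i, x i = r := by
  have hconv : Convex ℝ {x : Fin (m + r) → ℝ | ∑ i, x i = r} := by
    intro x hx y hy s t _ _ hst
    simp only [Set.mem_ofPred_eq] at *
    simp only [Pi.add_apply, Pi.smul_apply, smul_eq_mul, Finset.sum_add_distrib,
      ← Finset.mul_sum, hx, hy]
    rw [← add_mul, hst, one_mul]
  have hsub : LPMPoly m r P Q ⊆ {x | ∑ i, x i = r} := by
    refine convexHull_min ?_ hconv
    rintro _ ⟨B, hB, rfl⟩
    exact (sum_ind hB.1).trans (by rw [hB.2.1])
  exact hsub hx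

/-- A point of the polytope agreeing with `B` off the exchanged elements `a`, `b` lies on the
segment from `B` to the exchanged basis. -/
lemma mem_segment_swapElem {B : Finset ℕ} {a b : ℕ} (hB : IsLPBasis m r P Q B)
    (ha : a ∈ B) (hb : b ∉ B) (hbn : b ∈ Finset.Icc 1 (m + r))
    {x : Fin (m + r) → ℝ} (hx : x ∈ LPMPoly m r P Q)
    (h : ∀ i : Fin (m + r), (i : ℕ) + 1 ≠ a → (i : ℕ) + 1 ≠ b → x i = ind (m + r) B i) :
    x ∈ segment ℝ (ind (m + r) B) (ind (m + r) (swapElem B a b)) := by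
  have hab : a ≠ b := by rintro rfl; exact hb ha
  have ha' := Finset.mem_Icc.1 (hB.1 ha)
  have hb' := Finset.mem_Icc.1 hbn
  obtain ⟨ia, hia⟩ : ∃ i : Fin (m + r), (i : ℕ) + 1 = a := ⟨⟨a - 1, by omega⟩, by simp; omega⟩
  obtain ⟨ib, hib⟩ : ∃ i : Fin (m + r), (i : ℕ) + 1 = b := ⟨⟨b - 1, by omega⟩, by simp; omega⟩
  have hne : ia ≠ ib := by rintro rfl; omega
  have hsum : ∑ i, (x i - ind (m + r) B i) = 0 := by
    rw [Finset.sum_sub_distrib, sum_eq_of_mem_LPMPoly hx, sum_ind hB.1, hB.2.1, sub_self]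
  have hBa : ind (m + r) B ia = 1 := by simp [ind, hia, ha]
  have hBb : ind (m + r) B ib = 0 := by simp [ind, hib, hb]
  have hxab : x ia + x ib = 1 := by
    rw [Fintype.sum_eq_add ia ib hne] at hsum
    · rw [hBa, hBb] at hsum; linarith
    · rintro i ⟨h1, h2⟩
      rw [h i, sub_self]
      · intro h3; exact h1 (Fin.ext (by omega))
      · intro h3; exact h2 (Fin.ext (by omega))
  refine ⟨x ia, x ib, (LPMPoly_subset_cube hx ia).1, (LPMPoly_subset_cube hx ib).1, hxab, ?_⟩
  ext i
  simp only [Pi.add_apply, Pi.smul_apply, smul_eq_mul]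
  by_cases h1 : i = ia
  · subst h1
    have : ind (m + r) (swapElem B a b) i = 0 := by simp [ind, swapElem, hia, hab]
    rw [this, hBa]; ring
  by_cases h2 : i = ib
  · subst h2
    have : ind (m + r) (swapElem B a b) i = 1 := by simp [ind, swapElem, hib]
    rw [this, hBb]; ring
  have h1' : (i : ℕ) + 1 ≠ a := fun h3 => h1 (Fin.ext (by omega))
  have h2' : (i : ℕ) + 1 ≠ b := fun h3 => h2 (Fin.ext (by omega))
  have : ind (m + r) (swapElem B a b) i = ind (m + r) B i := by
    simp [ind, swapElem, h1', h2']
  rw [this, ← add_mul, hxab, one_mul, h i h1' h2']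

lemma isFace_segment_swapElem {B : Finset ℕ} {a b : ℕ} (hB : IsLPBasis m r P Q B)
    (hC : IsLPBasis m r P Q (swapElem B a b)) (ha : a ∈ B) (hb : b ∉ B)
    (hbn : b ∈ Finset.Icc 1 (m + r)) :
    IsFace (LPMPoly m r P Q) (segment ℝ (ind (m + r) B) (ind (m + r) (swapElem B a b))) := by
  refine ⟨(convex_convexHull ℝ _).segment_subset (ind_mem_LPMPoly hB) (ind_mem_LPMPoly hC),
    convex_segment _ _, ?_⟩
  rintro x hx y hy z ⟨s, t, hs, ht, hst, rfl⟩ ⟨u, v, -, -, huv, hz⟩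
  have key : ∀ i : Fin (m + r), (i : ℕ) + 1 ≠ a → (i : ℕ) + 1 ≠ b →
      x i = ind (m + r) B i ∧ y i = ind (m + r) B i := by
    intro i h1 h2
    have heq : ind (m + r) (swapElem B a b) i = ind (m + r) B i := by
      simp [ind, swapElem, h1, h2]
    have hzi := congrFun hz i
    simp only [Pi.add_apply, Pi.smul_apply, smul_eq_mul, heq] at hzi
    rw [← add_mul, huv, one_mul] at hzi
    obtain ⟨hx0, hx1⟩ := LPMPoly_subset_cube hx i
    obtain ⟨hy0, hy1⟩ := LPMPoly_subset_cube hy i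
    by_cases hi : (i : ℕ) + 1 ∈ B
    · have hone : ind (m + r) B i = 1 := by simp [ind, hi]
      rw [hone] at hzi ⊢
      constructor <;> nlinarith
    · have hzero : ind (m + r) B i = 0 := by simp [ind, hi]
      rw [hzero] at hzi ⊢
      constructor <;> nlinarith
  exact ⟨mem_segment_swapElem hB ha hb hbn hx fun i h1 h2 => (key i h1 h2).1,
    mem_segment_swapElem hB ha hb hbn hy fun i h1 h2 => (key i h1 h2).2⟩

lemma fdim_segment {n : ℕ} {x y : Fin n → ℝ} (h : x ≠ y) : fdim (segment ℝ x y) = 1 := by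
  rw [fdim, direction_affineSpan, vectorSpan_segment,
    finrank_span_singleton (vsub_ne_zero.2 h.symm)]

/-- A face of the convex hull of `V` lies in the convex hull of the points of `V` it contains. -/
lemma IsFace.subset_convexHull_inter {n : ℕ} {V F : Set (Fin n → ℝ)}
    (hF : IsFace (convexHull ℝ V) F) : F ⊆ convexHull ℝ (F ∩ V) := by
  have hsub : convexHull ℝ V ⊆ {x ∈ convexHull ℝ V | x ∈ F → x ∈ convexHull ℝ (F ∩ V)} := by
    refine convexHull_min (fun x hx => ⟨subset_convexHull ℝ V hx,
      fun hxF => subset_convexHull ℝ _ ⟨hxF, hx⟩⟩) (convex_iff_openSegment_subset.2 ?_)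
    rintro x ⟨hx, hx'⟩ y ⟨hy, hy'⟩ z hz
    refine ⟨(convex_convexHull ℝ V).openSegment_subset hx hy hz, fun hzF => ?_⟩
    obtain ⟨hxF, hyF⟩ := hF.2.2 x hx y hy z hz hzF
    exact (convex_convexHull ℝ _).openSegment_subset (hx' hxF) (hy' hyF) hz
  exact fun x hx => (hsub (hF.1 hx)).2 hx

lemma IsFace.exists_two_bases {F : Set (Fin (m + r) → ℝ)} (hF : IsFace (LPMPoly m r P Q) F)
    (hdim : fdim F = 1) :
    ∃ B C, IsLPBasis m r P Q B ∧ IsLPBasis m r P Q C ∧ ind (m + r) B ≠ ind (m + r) C ∧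
      ind (m + r) B ∈ F ∧ ind (m + r) C ∈ F := by
  by_contra! hcon
  have hss : (F ∩ ind (m + r) '' {B | IsLPBasis m r P Q B}).Subsingleton := by
    rintro _ ⟨h1, B, hB, rfl⟩ _ ⟨h2, C, hC, rfl⟩
    by_contra hne
    exact hcon B C hB hC hne h1 h2
  have hsub := hF.subset_convexHull_inter
  have hFss : F.Subsingleton := by
    rcases hss.eq_empty_or_singleton with h | ⟨x, h⟩
    · rw [h, convexHull_empty] at hsub
      exact Set.subsingleton_empty.anti hsub
    · rw [h, convexHull_singleton] at hsub
      exact Set.subsingleton_singleton.anti hsub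
  rw [fdim, direction_affineSpan, vectorSpan_of_subsingleton ℝ hFss, finrank_bot] at hdim
  exact zero_ne_one hdim

lemma IsFace.eq_segment {F : Set (Fin (m + r) → ℝ)} (hF : IsFace (LPMPoly m r P Q) F)
    (hdim : fdim F = 1) {B C : Finset ℕ} (hne : ind (m + r) B ≠ ind (m + r) C)
    (hB : ind (m + r) B ∈ F) (hC : ind (m + r) C ∈ F) :
    F = segment ℝ (ind (m + r) B) (ind (m + r) C) := by
  refine (Set.Subset.antisymm (hF.2.1.segment_subset hB hC) ?_).symm
  intro x hx
  have hcol : Collinear ℝ F := by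
    rw [collinear_iff_finrank_le_one, ← direction_affineSpan]
    exact hdim.le
  have hxl := hcol.mem_affineSpan_of_mem_of_ne hB hC hx hne
  obtain ⟨t, rfl⟩ := mem_affineSpan_pair_iff_exists_lineMap_eq.1 hxl
  obtain ⟨i, hi⟩ := Function.ne_iff.1 hne
  have hcube := LPMPoly_subset_cube (hF.1 hx) i
  rw [segment_eq_image_lineMap]
  refine ⟨t, ?_, rfl⟩
  simp only [AffineMap.lineMap_apply, Pi.vadd_apply', Pi.smul_apply, vsub_eq_sub,
    smul_eq_mul, vadd_eq_add, Pi.sub_apply, ind] at hcube hi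
  split_ifs at hcube hi <;> first | exact absurd rfl hi | constructor <;> linarith

end Polytope

lemma IsFace.eq_segment_swapElem_of_exchange {m r : ℕ} {Q : ℕ → Bool}
    {F : Set (Fin (m + r) → ℝ)} (hF : IsFace (LPMPoly m r (EmNr m) Q) F) (hdim : fdim F = 1)
    {B C : Finset ℕ} (hB : IsLPBasis m r (EmNr m) Q B) (hC : IsLPBasis m r (EmNr m) Q C)
    (hne : ind (m + r) B ≠ ind (m + r) C) (hBF : ind (m + r) B ∈ F) (hCF : ind (m + r) C ∈ F)
    {a b : ℕ} (ha : a ∈ B \ C) (hb : b ∈ C \ B) (hab : a < b) (h : ∀ c ∈ C, c < b → c ∈ B) :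
    F = segment ℝ (ind (m + r) B) (ind (m + r) (swapElem B a b)) := by
  have hseg := hF.eq_segment hdim hne hBF hCF
  have ha' := Finset.mem_sdiff.1 ha
  have hb' := Finset.mem_sdiff.1 hb
  have hD := isLPBasis_swapElem_of_lt hB ha'.1 hb'.2 (hC.1 hb'.1) hab
  have hE := isLPBasis_swapElem_of_forall hB hC ha hb h
  have hmid : (2⁻¹ : ℝ) • ind (m + r) B + (2⁻¹ : ℝ) • ind (m + r) C ∈ F := by
    rw [hseg]
    exact ⟨2⁻¹, 2⁻¹, by norm_num, by norm_num, by norm_num, rfl⟩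
  have hDF : ind (m + r) (swapElem B a b) ∈ F := by
    refine (hF.2.2 _ (ind_mem_LPMPoly hD) _ (ind_mem_LPMPoly hE) _ ?_ hmid).1
    refine ⟨2⁻¹, 2⁻¹, by norm_num, by norm_num, by norm_num, ?_⟩
    rw [← smul_add, ← smul_add, ind_swapElem_add ha hb]
  rw [hseg] at hDF
  rcases eq_or_eq_of_ind_mem_segment hDF with heq | heq
  · have := eq_of_ind_eq hD.1 hB.1 heq
    exact absurd (this ▸ Finset.mem_insert_self b (B.erase a) : b ∈ B) hb'.2
  · rw [heq, hseg]

/-- Inversions of the path of `B`: pairs of a North step followed by an East step. -/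
def inversions (n : ℕ) (B : Finset ℕ) : Finset (ℕ × ℕ) :=
  (B ×ˢ (Finset.Icc 1 n \ B)).filter fun p => p.1 < p.2

lemma mem_inversions {n : ℕ} {B : Finset ℕ} {p : ℕ × ℕ} :
    p ∈ inversions n B ↔ p.1 ∈ B ∧ p.2 ∈ Finset.Icc 1 n ∧ p.2 ∉ B ∧ p.1 < p.2 := by
  simp only [inversions, Finset.mem_filter, Finset.mem_product, Finset.mem_sdiff]
  tauto

lemma card_inversions (n : ℕ) (B : Finset ℕ) :
    (inversions n B).card = ∑ i ∈ Finset.Icc 1 n \ B, pathN B i := by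
  rw [inversions, Finset.card_filter, Finset.sum_product_right]
  refine Finset.sum_congr rfl fun i hi => ?_
  rw [pathN, Finset.card_filter]
  refine Finset.sum_congr rfl fun j hj => ?_
  have hne : j ≠ i := by
    rintro rfl
    exact (Finset.mem_sdiff.1 hi).2 hj
  simp only [hne.le_iff_lt]

/-- The heights at the ends of the North steps are `1, …, |B|`. -/
lemma sum_pathN_self (B : Finset ℕ) : ∑ i ∈ B, pathN B i = ∑ k ∈ Finset.range (B.card + 1), k := by
  induction B using Finset.induction_on_max with
  | empty => simp
  | insert a s hs ih =>
    have ha : a ∉ s := fun h => lt_irrefl a (hs a h)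
    have h1 : pathN (insert a s) a = s.card + 1 := by
      rw [pathN, Finset.filter_true_of_mem, Finset.card_insert_of_notMem ha]
      intro j hj
      rcases Finset.mem_insert.1 hj with rfl | hj
      · exact le_rfl
      · exact (hs j hj).le
    have h2 : ∀ i ∈ s, pathN (insert a s) i = pathN s i := by
      intro i hi
      rw [pathN, Finset.filter_insert, if_neg (hs i hi).not_ge, pathN]
    rw [Finset.sum_insert ha, h1, Finset.sum_congr rfl h2, ih, Finset.card_insert_of_notMem ha,
      Finset.sum_range_succ _ (s.card + 1)]
    ring

lemma sum_sub_NCt_EmNr {m r : ℕ} {Q : ℕ → Bool} {B : Finset ℕ}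
    (hB : IsLPBasis m r (EmNr m) Q B) :
    ∑ i ∈ Finset.Icc 1 (m + r), (pathN B i - NCt (EmNr m) i) = (inversions (m + r) B).card := by
  have hsum : ∑ i ∈ Finset.Icc 1 (m + r), NCt (EmNr m) i = ∑ k ∈ Finset.range (r + 1), k := by
    rw [← Nat.Ico_zero_eq_range, Finset.sum_eq_sum_Ico_succ_bot (by omega), zero_add, zero_add]
    have hsub : Finset.Icc (m + 1) (m + r) ⊆ Finset.Icc 1 (m + r) :=
      Finset.Icc_subset_Icc_left (by omega)
    rw [← Finset.sum_subset hsub]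
    · refine Finset.sum_bij' (fun i _ => i - m) (fun k _ => k + m) ?_ ?_ ?_ ?_ ?_ <;>
        intro i hi <;> simp only [Finset.mem_Icc, Finset.mem_Ico, NCt_EmNr] at * <;> omega
    · intro i h1 h2
      simp only [Finset.mem_Icc, NCt_EmNr] at *
      omega
  have hle : ∀ i ∈ Finset.Icc 1 (m + r), NCt (EmNr m) i ≤ pathN B i :=
    fun i hi => (hB.2.2 i (Finset.mem_Icc.1 hi).2).1
  rw [Finset.sum_tsub_distrib _ hle, hsum,
    card_inversions, ← Finset.sum_sdiff hB.1, sum_pathN_self, hB.2.1, Nat.add_sub_cancel]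

lemma eq_and_eq_of_swapElem_eq {B : Finset ℕ} {a b a' b' : ℕ} (ha : a ∈ B) (hb : b ∉ B)
    (ha' : a' ∈ B) (hb' : b' ∉ B) (h : swapElem B a b = swapElem B a' b') : a = a' ∧ b = b' := by
  have h1 := Finset.ext_iff.1 h a
  have h2 := Finset.ext_iff.1 h b
  simp only [swapElem, Finset.mem_insert, Finset.mem_erase] at h1 h2
  have hab : a ≠ b := by rintro rfl; exact hb ha
  have hab' : a ≠ b' := by rintro rfl; exact hb' ha
  have hba' : b ≠ a' := by rintro rfl; exact hb ha'
  constructor <;> tauto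

/-- The segment attached to a basis and an inversion of it. -/
noncomputable def edgeSegment (n : ℕ) (p : Σ _ : Finset ℕ, ℕ × ℕ) : Set (Fin n → ℝ) :=
  segment ℝ (ind n p.1) (ind n (swapElem p.1 p.2.1 p.2.2))

/-- The bases of `M[E^m N^r, Q]` together with one of their inversions. -/
noncomputable def basisInversions (m r : ℕ) (Q : ℕ → Bool) : Finset (Σ _ : Finset ℕ, ℕ × ℕ) :=
  (basesFinset m r (EmNr m) Q).sigma fun B => inversions (m + r) B

lemma edgeSegment_injOn (m r : ℕ) (Q : ℕ → Bool) :
    Set.InjOn (edgeSegment (m + r)) (basisInversions m r Q : Set (Σ _ : Finset ℕ, ℕ × ℕ)) := by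
  rintro ⟨B, a, b⟩ hp ⟨C, c, d⟩ hq heq
  simp only [basisInversions, Finset.coe_sigma, Set.mem_sigma_iff, Finset.mem_coe,
    mem_basesFinset, mem_inversions] at hp hq
  obtain ⟨hB, ha, hbn, hb, hab⟩ := hp
  obtain ⟨hC, hc, hdn, hd, hcd⟩ := hq
  simp only [edgeSegment] at heq
  have hB' := isLPBasis_swapElem_of_lt hB ha hb hbn hab
  have hC' := isLPBasis_swapElem_of_lt hC hc hd hdn hcd
  have e1 : B = C ∨ B = swapElem C c d :=
    (eq_or_eq_of_ind_mem_segment (heq ▸ left_mem_segment ℝ _ _)).imp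
      (eq_of_ind_eq hB.1 hC.1) (eq_of_ind_eq hB.1 hC'.1)
  have e2 : swapElem B a b = C ∨ swapElem B a b = swapElem C c d :=
    (eq_or_eq_of_ind_mem_segment (heq ▸ right_mem_segment ℝ _ _)).imp
      (eq_of_ind_eq hB'.1 hC.1) (eq_of_ind_eq hB'.1 hC'.1)
  have hbB' : b ∈ swapElem B a b := Finset.mem_insert_self _ _
  rcases e1 with rfl | e1
  · rcases e2 with e2 | e2
    · exact absurd (e2 ▸ hbB') hb
    · obtain ⟨rfl, rfl⟩ := eq_and_eq_of_swapElem_eq ha hb hc hd e2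
      rfl
  · rcases e2 with e2 | e2
    · have h1 := Finset.ext_iff.1 e1 c
      have h2 := Finset.ext_iff.1 e2 c
      have h3 := Finset.ext_iff.1 e1 d
      have h4 := Finset.ext_iff.1 e2 d
      simp only [swapElem, Finset.mem_insert, Finset.mem_erase] at h1 h2 h3 h4
      have hcb : c = b := by
        have : c ≠ d := hcd.ne
        tauto
      have hda : d = a := by
        tauto
      omega
    · exact absurd (e1.trans e2.symm ▸ hb) (fun h => h hbB')

lemma edges_eq_image (m r : ℕ) (Q : ℕ → Bool) :
    {F : Set (Fin (m + r) → ℝ) | IsFace (LPMPoly m r (EmNr m) Q) F ∧ fdim F = 1} =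
      edgeSegment (m + r) '' (basisInversions m r Q : Set (Σ _ : Finset ℕ, ℕ × ℕ)) := by
  ext F
  simp only [Set.mem_ofPred_eq, Set.mem_image, basisInversions, Finset.mem_coe, Finset.mem_sigma,
    mem_basesFinset, mem_inversions]
  constructor
  · rintro ⟨hF, hdim⟩
    obtain ⟨B, C, hB, hC, hne, hBF, hCF⟩ := hF.exists_two_bases hdim
    rcases exists_first_exchange (fun h => hne (congrArg _ h)) (hB.2.1.trans hC.2.1.symm) with
      ⟨a, ha, b, hb, hab, h⟩ | ⟨a, ha, b, hb, hab, h⟩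
    · have ha' := Finset.mem_sdiff.1 ha
      have hb' := Finset.mem_sdiff.1 hb
      exact ⟨⟨B, a, b⟩, ⟨hB, ha'.1, hC.1 hb'.1, hb'.2, hab⟩,
        (hF.eq_segment_swapElem_of_exchange hdim hB hC hne hBF hCF ha hb hab h).symm⟩
    · have ha' := Finset.mem_sdiff.1 ha
      have hb' := Finset.mem_sdiff.1 hb
      exact ⟨⟨C, a, b⟩, ⟨hC, ha'.1, hB.1 hb'.1, hb'.2, hab⟩,
        (hF.eq_segment_swapElem_of_exchange hdim hC hB hne.symm hCF hBF ha hb hab h).symm⟩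
  · rintro ⟨⟨B, a, b⟩, ⟨hB, ha, hbn, hb, hab⟩, rfl⟩
    have hB' := isLPBasis_swapElem_of_lt hB ha hb hbn hab
    refine ⟨isFace_segment_swapElem hB hB' ha hb hbn, fdim_segment fun h => hb ?_⟩
    rw [eq_of_ind_eq hB.1 hB'.1 h]
    exact Finset.mem_insert_self _ _

/-- Bidkhori's lemma: the number of edges of the lattice path matroid polytope
`P(M[E^m N^r, Q])` equals the sum, over all lattice paths `L` from `(0,0)` to
`(m,r)` never going above `Q`, of the area below `L`. -/
theorem lpm_edge_count_bottom (m r : ℕ) (Q : ℕ → Bool)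
    (hQ : IsPath m r Q) (hPQ : Below (m + r) (EmNr m) Q) :
    Nat.card {F : Set (Fin (m + r) → ℝ) |
        IsFace (LPMPoly m r (EmNr m) Q) F ∧ fdim F = 1} =
      ∑ B ∈ basesFinset m r (EmNr m) Q, ∑ i ∈ Finset.Icc 1 (m + r),
        (pathN B i - NCt (EmNr m) i) := by
  rw [edges_eq_image, Nat.card_coe_set_eq, (edgeSegment_injOn m r Q).ncard_image,
    Set.ncard_coe_finset, basisInversions, Finset.card_sigma]
  exact Finset.sum_congr rfl fun B hB => (sum_sub_NCt_EmNr (mem_basesFinset.1 hB)).symm
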